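/- Let f : (0,∞) → ℝ be a non-affine subentropic function and set g(t) = 1/f''(t) for t > 0. Then g is increasing on (0,∞) and g(t) → 0 as t → 0⁺; equivalently, f''(t) → ∞ as t tends to zero. -/

import Mathlib

open scoped Matrix
open Matrix
open scoped ComplexOrder

noncomputable section

/-- The trace of `f` applied (by the functional calculus) to a Hermitian matrix,
computed via the eigenvalues.  Junk value `0` on non-Hermitian matrices. -/
def trFn (f : ℝ → ℝ) {d : Type} [Fintype d] [DecidableEq d] (ρ : Matrix d d ℂ) : ℝ :=
  if hρ : ρ.IsHermitian then ∑ i, f (hρ.eigenvalues i) else 0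

/-- `f` applied to a Hermitian matrix by the functional calculus (spectral theorem).
Junk value `0` on non-Hermitian matrices. -/
def matFn (f : ℝ → ℝ) {d : Type} [Fintype d] [DecidableEq d] (ρ : Matrix d d ℂ) :
    Matrix d d ℂ :=
  if hρ : ρ.IsHermitian then
    (hρ.eigenvectorUnitary : Matrix d d ℂ) *
      Matrix.diagonal (fun i => (f (hρ.eigenvalues i) : ℂ)) *
      star (hρ.eigenvectorUnitary : Matrix d d ℂ)
  else 0

/-- The partial trace over the second factor of a bipartite system `H₁ ⊗ H₂`,
where operators on `H₁ ⊗ H₂` are modelled as matrices indexed by `Fin m × Fin n`. -/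
def partialTrace {m n : ℕ} (ρ : Matrix (Fin m × Fin n) (Fin m × Fin n) ℂ) :
    Matrix (Fin m) (Fin m) ℂ :=
  Matrix.of fun i j => ∑ k : Fin n, ρ (i, k) (j, k)

/-- A convex function `f : (0,∞) → ℝ` is entropic if on every finite-dimensional
bipartite system the map `ρ ↦ -Tr f(ρ₁) + Tr f(ρ)` is convex in positive definite `ρ`,
where `ρ₁` is the partial trace of `ρ` on the first factor. -/
def IsEntropic (f : ℝ → ℝ) : Prop :=
  ConvexOn ℝ (Set.Ioi (0 : ℝ)) f ∧
  ∀ m n : ℕ,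
    ConvexOn ℝ {ρ : Matrix (Fin m × Fin n) (Fin m × Fin n) ℂ | ρ.PosDef}
      (fun ρ => - trFn f (partialTrace ρ) + trFn f ρ)

/-- A convex function `f : (0,∞) → ℝ` is subentropic of order `k` if
`G(ρ₁,…,ρ_k) = -Tr f(ρ₁+⋯+ρ_k) + Tr f(ρ₁) + ⋯ + Tr f(ρ_k)` is convex in `k`-tuples of
positive definite operators on any finite-dimensional Hilbert space. -/
def SubentropicOfOrder (f : ℝ → ℝ) (k : ℕ) : Prop :=
  ConvexOn ℝ (Set.Ioi (0 : ℝ)) f ∧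
  ∀ n : ℕ,
    ConvexOn ℝ {ρ : Fin k → Matrix (Fin n) (Fin n) ℂ | ∀ i, (ρ i).PosDef}
      (fun ρ => - trFn f (∑ i, ρ i) + ∑ i, trFn f (ρ i))

/-- A function is subentropic if it is subentropic of all orders. -/
def Subentropic (f : ℝ → ℝ) : Prop :=
  ∀ k : ℕ, SubentropicOfOrder f k

/-- Divided difference of `g`, with `g'` on the diagonal. -/
def divDiff (g : ℝ → ℝ) (x y : ℝ) : ℝ :=
  if x = y then deriv g x else (g x - g y) / (x - y)

/-- Conjugation `h ↦ U * h * U*` as a linear operator on matrices. -/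
def conjEnd {n : ℕ} (U : Matrix (Fin n) (Fin n) ℂ) :
    Module.End ℂ (Matrix (Fin n) (Fin n) ℂ) :=
  (LinearMap.mulLeft ℂ U).comp (LinearMap.mulRight ℂ (star U))

/-- Hadamard (entrywise) multiplication by a fixed matrix `L`, as a linear operator. -/
def hadamardEnd {n : ℕ} (L : Matrix (Fin n) (Fin n) ℂ) :
    Module.End ℂ (Matrix (Fin n) (Fin n) ℂ) where
  toFun h := L ⊙ h
  map_add' h₁ h₂ := Matrix.hadamard_add L h₁ h₂
  map_smul' c h := Matrix.hadamard_smul L h c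

/-- The Fréchet differential `dg(ρ)` of the matrix function induced by `g` at the
Hermitian matrix `ρ`: in a basis diagonalising `ρ` it acts as the Hadamard product
with the Löwner matrix of divided differences of `g`.  Junk value `0` at
non-Hermitian matrices. -/
def frechetDiff (g : ℝ → ℝ) {n : ℕ} (ρ : Matrix (Fin n) (Fin n) ℂ) :
    Module.End ℂ (Matrix (Fin n) (Fin n) ℂ) :=
  if hρ : ρ.IsHermitian then
    (conjEnd (hρ.eigenvectorUnitary : Matrix (Fin n) (Fin n) ℂ)).comp
      ((hadamardEnd (Matrix.of fun i j =>
          (divDiff g (hρ.eigenvalues i) (hρ.eigenvalues j) : ℂ))).comp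
        (conjEnd (star (hρ.eigenvectorUnitary : Matrix (Fin n) (Fin n) ℂ))))
  else 0

/-- The order, with respect to the trace inner product, between operators on `B(H)`:
`T ≤ S` iff `S - T` is a positive superoperator. -/
def endLE {n : ℕ} (T S : Module.End ℂ (Matrix (Fin n) (Fin n) ℂ)) : Prop :=
  ∀ h : Matrix (Fin n) (Fin n) ℂ, 0 ≤ Matrix.trace (star h * (S h - T h))

/-- The harmonic mean `H₂(A,B) = 2 (A⁻¹ + B⁻¹)⁻¹` of two (positive definite, hence
invertible) operators on `B(H)`. -/
def harmonicMeanEnd {n : ℕ} (A B : Module.End ℂ (Matrix (Fin n) (Fin n) ℂ)) :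
    Module.End ℂ (Matrix (Fin n) (Fin n) ℂ) :=
  (2 : ℂ) • Ring.inverse (Ring.inverse A + Ring.inverse B)

/-- The amplification `id_n ⊗ Φ` of a linear map on matrices. -/
def amplify {m k : ℕ} (Φ : Matrix (Fin m) (Fin m) ℂ →ₗ[ℂ] Matrix (Fin k) (Fin k) ℂ)
    (n : ℕ) (A : Matrix (Fin n × Fin m) (Fin n × Fin m) ℂ) :
    Matrix (Fin n × Fin k) (Fin n × Fin k) ℂ :=
  Matrix.of fun p q => Φ (Matrix.of fun x y => A (p.1, x) (q.1, y)) p.2 q.2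

/-- A linear map on matrices is completely positive if all its amplifications
preserve positive semidefiniteness. -/
def IsCompletelyPositive {m k : ℕ}
    (Φ : Matrix (Fin m) (Fin m) ℂ →ₗ[ℂ] Matrix (Fin k) (Fin k) ℂ) : Prop :=
  ∀ n : ℕ, ∀ A : Matrix (Fin n × Fin m) (Fin n × Fin m) ℂ,
    A.PosSemidef → (amplify Φ n A).PosSemidef

/-- A quantum channel is a completely positive trace preserving linear map. -/
def IsQuantumChannel {m k : ℕ}
    (Φ : Matrix (Fin m) (Fin m) ℂ →ₗ[ℂ] Matrix (Fin k) (Fin k) ℂ) : Prop :=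
  IsCompletelyPositive Φ ∧ ∀ A, (Φ A).trace = A.trace

/-- The real symmetric `2 × 2` matrix with eigenvalues `m ± √(x ^ 2 + y ^ 2)`. -/
def symmTwo (m x y : ℝ) : Matrix (Fin 2) (Fin 2) ℂ :=
  !![((m + x : ℝ) : ℂ), (y : ℂ); (y : ℂ), ((m - x : ℝ) : ℂ)]

/-- The sum of the values of `f` at the eigenvalues of `symmTwo m x y`. -/
def trTwo (f : ℝ → ℝ) (m x y : ℝ) : ℝ :=
  f (m + √(x ^ 2 + y ^ 2)) + f (m - √(x ^ 2 + y ^ 2))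

lemma symmTwo_isHermitian (m x y : ℝ) : (symmTwo m x y).IsHermitian := by
  ext i j
  fin_cases i <;> fin_cases j <;> simp [symmTwo]

lemma symmTwo_eigenvalues (m x y : ℝ) :
    let h := (symmTwo_isHermitian m x y).eigenvalues
    (h 0 = m + √(x ^ 2 + y ^ 2) ∧ h 1 = m - √(x ^ 2 + y ^ 2)) ∨
      (h 0 = m - √(x ^ 2 + y ^ 2) ∧ h 1 = m + √(x ^ 2 + y ^ 2)) := by
  intro h
  have htr : h 0 + h 1 = 2 * m := by
    have h1 : (symmTwo m x y).trace = ((2 * m : ℝ) : ℂ) := by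
      simp [symmTwo, Matrix.trace_fin_two_of, two_mul]
    rw [(symmTwo_isHermitian m x y).trace_eq_sum_eigenvalues, Fin.sum_univ_two] at h1
    exact Complex.ofReal_injective ((Complex.ofReal_add _ _).trans h1)
  have hdet : h 0 * h 1 = m ^ 2 - (x ^ 2 + y ^ 2) := by
    have h1 : (symmTwo m x y).det = ((m ^ 2 - (x ^ 2 + y ^ 2) : ℝ) : ℂ) := by
      simp [symmTwo, Matrix.det_fin_two_of]
      ring
    rw [(symmTwo_isHermitian m x y).det_eq_prod_eigenvalues, Fin.prod_univ_two] at h1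
    exact Complex.ofReal_injective ((Complex.ofReal_mul _ _).trans h1)
  have hs : √(x ^ 2 + y ^ 2) ^ 2 = x ^ 2 + y ^ 2 := Real.sq_sqrt (by positivity)
  have hfac : (h 0 - (m + √(x ^ 2 + y ^ 2))) * (h 0 - (m - √(x ^ 2 + y ^ 2))) = 0 := by
    have : h 1 = 2 * m - h 0 := by linarith
    rw [this] at hdet
    nlinarith
  rcases mul_eq_zero.mp hfac with h0 | h0
  · left; constructor <;> linarith
  · right; constructor <;> linarith

lemma trFn_symmTwo (f : ℝ → ℝ) (m x y : ℝ) : trFn f (symmTwo m x y) = trTwo f m x y := by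
  rw [trFn, dif_pos (symmTwo_isHermitian m x y), Fin.sum_univ_two, trTwo]
  rcases symmTwo_eigenvalues m x y with ⟨h0, h1⟩ | ⟨h0, h1⟩
  · rw [h0, h1]
  · rw [h0, h1, add_comm]

lemma symmTwo_posDef {m x y : ℝ} (h : √(x ^ 2 + y ^ 2) < m) : (symmTwo m x y).PosDef := by
  rw [(symmTwo_isHermitian m x y).posDef_iff_eigenvalues_pos]
  have hs := Real.sqrt_nonneg (x ^ 2 + y ^ 2)
  intro i
  rcases symmTwo_eigenvalues m x y with ⟨h0, h1⟩ | ⟨h0, h1⟩ <;> fin_cases i <;>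
    simp only [Fin.zero_eta, Fin.mk_one, h0, h1] <;> linarith

lemma symmTwo_add (m x y m' x' y' : ℝ) :
    symmTwo m x y + symmTwo m' x' y' = symmTwo (m + m') (x + x') (y + y') := by
  ext i j
  fin_cases i <;> fin_cases j <;> (simp [symmTwo]; try ring)

lemma symmTwo_smul (a m x y : ℝ) :
    a • symmTwo m x y = symmTwo (a * m) (a * x) (a * y) := by
  ext i j
  fin_cases i <;> fin_cases j <;> (simp [symmTwo]; try ring)

lemma Subentropic.trTwo_le {f : ℝ → ℝ} (hf : Subentropic f) {a b : ℝ} (ha : 0 ≤ a) (hb : 0 ≤ b)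
    (hab : a + b = 1) {m₁ x₁ y₁ m₂ x₂ y₂ m₃ x₃ y₃ m₄ x₄ y₄ : ℝ}
    (h₁ : √(x₁ ^ 2 + y₁ ^ 2) < m₁) (h₂ : √(x₂ ^ 2 + y₂ ^ 2) < m₂)
    (h₃ : √(x₃ ^ 2 + y₃ ^ 2) < m₃) (h₄ : √(x₄ ^ 2 + y₄ ^ 2) < m₄) :
    -trTwo f (a * m₁ + b * m₂ + (a * m₃ + b * m₄)) (a * x₁ + b * x₂ + (a * x₃ + b * x₄))
        (a * y₁ + b * y₂ + (a * y₃ + b * y₄)) +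
      (trTwo f (a * m₁ + b * m₂) (a * x₁ + b * x₂) (a * y₁ + b * y₂) +
        trTwo f (a * m₃ + b * m₄) (a * x₃ + b * x₄) (a * y₃ + b * y₄)) ≤
    a * (-trTwo f (m₁ + m₃) (x₁ + x₃) (y₁ + y₃) + (trTwo f m₁ x₁ y₁ + trTwo f m₃ x₃ y₃)) +
      b * (-trTwo f (m₂ + m₄) (x₂ + x₄) (y₂ + y₄) + (trTwo f m₂ x₂ y₂ + trTwo f m₄ x₄ y₄)) := by
  have key := ((hf 2).2 2).2 (x := ![symmTwo m₁ x₁ y₁, symmTwo m₃ x₃ y₃])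
    (y := ![symmTwo m₂ x₂ y₂, symmTwo m₄ x₄ y₄])
    (by intro i; fin_cases i; exacts [symmTwo_posDef h₁, symmTwo_posDef h₃])
    (by intro i; fin_cases i; exacts [symmTwo_posDef h₂, symmTwo_posDef h₄]) ha hb hab
  simpa [Fin.sum_univ_two, symmTwo_smul, symmTwo_add, trFn_symmTwo] using key

lemma trTwo_zero_zero (f : ℝ → ℝ) (m : ℝ) : trTwo f m 0 0 = 2 * f m := by
  simp [trTwo]; ring

lemma Subentropic.scalar_le {f : ℝ → ℝ} (hf : Subentropic f) {a b : ℝ} (ha : 0 ≤ a) (hb : 0 ≤ b)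
    (hab : a + b = 1) {s₁ s₂ t₁ t₂ : ℝ} (hs₁ : 0 < s₁) (hs₂ : 0 < s₂) (ht₁ : 0 < t₁)
    (ht₂ : 0 < t₂) :
    -f (a * s₁ + b * s₂ + (a * t₁ + b * t₂)) + (f (a * s₁ + b * s₂) + f (a * t₁ + b * t₂)) ≤
      a * (-f (s₁ + t₁) + (f s₁ + f t₁)) + b * (-f (s₂ + t₂) + (f s₂ + f t₂)) := by
  have key := hf.trTwo_le ha hb hab (m₁ := s₁) (m₂ := s₂) (m₃ := t₁) (m₄ := t₂) (x₁ := 0) (x₂ := 0)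
    (x₃ := 0) (x₄ := 0) (y₁ := 0) (y₂ := 0) (y₃ := 0) (y₄ := 0) (by simpa) (by simpa) (by simpa)
    (by simpa)
  simp only [mul_zero, add_zero, trTwo_zero_zero] at key
  linarith

open Set in
lemma HasDerivWithinAt.hasDerivAt_of_Iio_Ioi {h : ℝ → ℝ} {h' t : ℝ}
    (hl : HasDerivWithinAt h h' (Iio t) t) (hr : HasDerivWithinAt h h' (Ioi t) t) :
    HasDerivAt h h' t := by
  rw [hasDerivAt_iff_tendsto_slope_left_right]
  exact ⟨(hasDerivWithinAt_iff_tendsto_slope' (by simp)).mp hl,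
    (hasDerivWithinAt_iff_tendsto_slope' (by simp)).mp hr⟩

open Set Filter Topology in
lemma HasDerivWithinAt.tendsto_div_right {h : ℝ → ℝ} {h' : ℝ}
    (H : HasDerivWithinAt h h' (Ioi 0) 0) :
    Tendsto (fun ε => (h ε - h 0) / ε) (𝓝[>] 0) (𝓝 h') := by
  have := (hasDerivWithinAt_iff_tendsto_slope' (by simp)).mp H
  refine this.congr fun ε => ?_
  rw [slope_def_field, sub_zero]

open Set Filter Topology in
lemma HasDerivWithinAt.tendsto_div_add_mul {φ : ℝ → ℝ} {c t s : ℝ} {S : Set ℝ}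
    (H : HasDerivWithinAt φ c S t) (hS : ∀ ε > 0, t + ε * s ∈ S) :
    Tendsto (fun ε => (φ (t + ε * s) - φ t) / ε) (𝓝[>] 0) (𝓝 (c * s)) := by
  have h1 : HasDerivWithinAt (fun ε : ℝ => t + ε * s) s (Ioi 0) 0 := by
    simpa using (((hasDerivAt_id (0 : ℝ)).mul_const s).const_add t).hasDerivWithinAt
  have h2 : HasDerivWithinAt (φ ∘ fun ε : ℝ => t + ε * s) (c * s) (Ioi 0) 0 :=
    HasDerivWithinAt.comp (0 : ℝ) (s' := S) (by simpa using H) h1 (fun ε hε => hS ε hε)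
  simpa using h2.tendsto_div_right

lemma Subentropic.convexOn {f : ℝ → ℝ} (hf : Subentropic f) : ConvexOn ℝ (Set.Ioi 0) f :=
  (hf 2).1

open Set Filter Topology in
lemma Subentropic.concaveOn_rightDeriv {f : ℝ → ℝ} (hf : Subentropic f) :
    ConcaveOn ℝ (Ioi 0) (fun t => derivWithin f (Ioi t) t) := by
  have hlim : ∀ t : ℝ, 0 < t →
      Tendsto (fun ε => (f (t + ε) - f t) / ε) (𝓝[>] 0) (𝓝 (derivWithin f (Ioi t) t)) := by
    intro t ht
    have := (hf.convexOn.hasDerivWithinAt_rightDeriv_of_mem_interior (x := t)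
      (by simpa using ht)).tendsto_div_add_mul (s := 1) (by intro ε hε; simpa using hε)
    simpa using this
  refine ⟨convex_Ioi 0, fun x hx y hy a b ha hb hab => ?_⟩
  simp only [smul_eq_mul, mem_Ioi] at hx hy ⊢
  have hxy : 0 < a * x + b * y := convex_Ioi (0 : ℝ) hx hy ha hb hab
  refine le_of_tendsto_of_tendsto (((hlim x hx).const_mul a).add ((hlim y hy).const_mul b))
    (hlim _ hxy) ?_
  filter_upwards [self_mem_nhdsWithin] with ε (hε : 0 < ε)
  have key := hf.scalar_le ha hb hab hx hy hε hε
  rw [← add_mul a b ε, hab, one_mul] at key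
  have hfb : f ε = a * f ε + b * f ε := by rw [← add_mul, hab, one_mul]
  rw [← mul_div_assoc, ← mul_div_assoc, ← add_div]
  gcongr
  linarith

open Set Filter Topology in
lemma Subentropic.differentiableAt {f : ℝ → ℝ} (hf : Subentropic f) {t : ℝ} (ht : 0 < t) :
    DifferentiableAt ℝ f t := by
  have hti : t ∈ interior (Ioi (0 : ℝ)) := by simpa using ht
  have hR := hf.convexOn.hasDerivWithinAt_rightDeriv_of_mem_interior hti
  have hL := hf.convexOn.hasDerivWithinAt_leftDeriv_of_mem_interior hti
  have hLR := hf.convexOn.leftDeriv_le_rightDeriv_of_mem_interior hti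
  have hRL : derivWithin f (Ioi t) t ≤ derivWithin f (Iio t) t := by
    have hcont : ContinuousAt (fun t => derivWithin f (Ioi t) t) t :=
      (hf.concaveOn_rightDeriv.continuousOn isOpen_Ioi).continuousAt (Ioi_mem_nhds ht)
    refine le_of_tendsto (hcont.tendsto.mono_left (nhdsWithin_le_nhds (s := Iio t))) ?_
    filter_upwards [self_mem_nhdsWithin, nhdsWithin_le_nhds (Ioi_mem_nhds ht)]
      with s (hst : s < t) (hs : 0 < s)
    exact (hf.convexOn.rightDeriv_le_slope_of_mem_interior (by simpa using hs) ht hst).trans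
      (hf.convexOn.slope_le_leftDeriv_of_mem_interior hs hti hst)
  rw [le_antisymm hRL hLR] at hR
  exact (hL.hasDerivAt_of_Iio_Ioi hR).differentiableAt

open Set in
lemma Subentropic.concaveOn_deriv {f : ℝ → ℝ} (hf : Subentropic f) :
    ConcaveOn ℝ (Ioi 0) (deriv f) :=
  hf.concaveOn_rightDeriv.congr fun t ht =>
    (hf.differentiableAt ht).derivWithin (uniqueDiffWithinAt_Ioi t)

open Set in
lemma Subentropic.monotoneOn_deriv {f : ℝ → ℝ} (hf : Subentropic f) :
    MonotoneOn (deriv f) (Ioi 0) :=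
  hf.convexOn.monotoneOn_deriv fun _ ht => hf.differentiableAt ht

lemma hasDerivAt_trTwo {f : ℝ → ℝ} {m x y r q : ℝ} (hr : 0 < r) (hxy : r ^ 2 = x ^ 2 + y ^ 2)
    (h₁ : DifferentiableAt ℝ f (m + r)) (h₂ : DifferentiableAt ℝ f (m - r)) :
    HasDerivAt (fun ε => trTwo f (m + ε) (x + ε * q) y)
      (deriv f (m + r) * (1 + q * (x / r)) + deriv f (m - r) * (1 - q * (x / r))) 0 := by
  have hsqrt : √(x ^ 2 + y ^ 2) = r := by rw [← hxy, Real.sqrt_sq hr.le]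
  have hm : HasDerivAt (fun ε : ℝ => m + ε) 1 0 := (hasDerivAt_id (0 : ℝ)).const_add m
  have hx : HasDerivAt (fun ε : ℝ => x + ε * q) q 0 := by
    simpa using ((hasDerivAt_id (0 : ℝ)).mul_const q).const_add x
  have hs : HasDerivAt (fun ε : ℝ => √((x + ε * q) ^ 2 + y ^ 2)) (q * (x / r)) 0 := by
    have hsq : HasDerivAt (fun ε : ℝ => (x + ε * q) ^ 2 + y ^ 2) (2 * x * q) 0 := by
      simpa using (hx.fun_pow 2).add_const (y ^ 2)
    have := hsq.sqrt (by simp only [zero_mul, add_zero, ← hxy]; positivity)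
    simp only [zero_mul, add_zero, hsqrt] at this
    convert this using 1
    field_simp
  have hp := HasDerivAt.comp (0 : ℝ) (h₂ := f) (h₂' := deriv f (m + r))
    (h := fun ε : ℝ => m + ε + √((x + ε * q) ^ 2 + y ^ 2))
    (by simpa only [zero_mul, add_zero, hsqrt] using h₁.hasDerivAt) (hm.add hs)
  have hn := HasDerivAt.comp (0 : ℝ) (h₂ := f) (h₂' := deriv f (m - r))
    (h := fun ε : ℝ => m + ε - √((x + ε * q) ^ 2 + y ^ 2))
    (by simpa only [zero_mul, add_zero, hsqrt] using h₂.hasDerivAt) (hm.sub hs)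
  exact hp.add hn

open Set Filter Topology in
/-- Concavity of `ρ ↦ Tr (deriv f)(ρ) P` on real symmetric `2 × 2` matrices, where `P` is twice the
projection onto the first coordinate. -/
lemma Subentropic.deriv_two_le {f : ℝ → ℝ} (hf : Subentropic f) {a b : ℝ} (ha : 0 ≤ a)
    (hb : 0 ≤ b) (hab : a + b = 1) {x m₁ y₁ r₁ m₂ y₂ r₂ m y r : ℝ}
    (hr₁ : 0 < r₁) (hr₂ : 0 < r₂) (hr : 0 < r) (hrm₁ : r₁ < m₁) (hrm₂ : r₂ < m₂) (hrm : r < m)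
    (hm : m = a * m₁ + b * m₂) (hy : y = a * y₁ + b * y₂)
    (h₁ : r₁ ^ 2 = x ^ 2 + y₁ ^ 2) (h₂ : r₂ ^ 2 = x ^ 2 + y₂ ^ 2) (h : r ^ 2 = x ^ 2 + y ^ 2) :
    a * (deriv f (m₁ + r₁) * (1 + x / r₁) + deriv f (m₁ - r₁) * (1 - x / r₁)) +
      b * (deriv f (m₂ + r₂) * (1 + x / r₂) + deriv f (m₂ - r₂) * (1 - x / r₂)) ≤
    deriv f (m + r) * (1 + x / r) + deriv f (m - r) * (1 - x / r) := by
  have hlim : ∀ q m y r : ℝ, 0 < r → r < m → r ^ 2 = x ^ 2 + y ^ 2 →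
      Tendsto (fun ε => (trTwo f (m + ε) (x + ε * q) y - trTwo f m x y) / ε) (𝓝[>] 0)
        (𝓝 (deriv f (m + r) * (1 + q * (x / r)) + deriv f (m - r) * (1 - q * (x / r)))) := by
    intro q m y r hr hrm h
    have := (hasDerivAt_trTwo (q := q) hr h (hf.differentiableAt (by linarith))
      (hf.differentiableAt (t := m - r) (by linarith))).hasDerivWithinAt (s := Ioi 0)
    simpa using this.tendsto_div_right
  have hq : ∀ q : ℝ, 0 ≤ q → q < 1 →
      a * (deriv f (m₁ + r₁) * (1 + q * (x / r₁)) + deriv f (m₁ - r₁) * (1 - q * (x / r₁))) +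
      b * (deriv f (m₂ + r₂) * (1 + q * (x / r₂)) + deriv f (m₂ - r₂) * (1 - q * (x / r₂))) ≤
      deriv f (m + r) * (1 + q * (x / r)) + deriv f (m - r) * (1 - q * (x / r)) := by
    intro q hq0 hq1
    refine le_of_tendsto_of_tendsto (((hlim q m₁ y₁ r₁ hr₁ hrm₁ h₁).const_mul a).add
      ((hlim q m₂ y₂ r₂ hr₂ hrm₂ h₂).const_mul b)) (hlim q m y r hr hrm h) ?_
    filter_upwards [self_mem_nhdsWithin] with ε (hε : 0 < ε)
    have hP : √((ε * q) ^ 2 + 0 ^ 2) < ε := by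
      rw [zero_pow two_ne_zero, add_zero, Real.sqrt_sq (by positivity)]
      nlinarith
    have hρ : ∀ m y r : ℝ, 0 < r → r < m → r ^ 2 = x ^ 2 + y ^ 2 → √(x ^ 2 + y ^ 2) < m := by
      intro m y r hr hrm h
      rwa [← h, Real.sqrt_sq hr.le]
    have key := hf.trTwo_le ha hb hab (hρ _ _ _ hr₁ hrm₁ h₁) (hρ _ _ _ hr₂ hrm₂ h₂) hP hP
    have hcomb : ∀ z : ℝ, a * z + b * z = z := fun z => by rw [← add_mul, hab, one_mul]
    simp only [hcomb, add_zero, ← hm, ← hy] at key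
    have hε' := hcomb (trTwo f ε (ε * q) 0)
    rw [← mul_div_assoc, ← mul_div_assoc, ← add_div]
    gcongr
    linarith
  have hcont : ∀ c d z : ℝ, Tendsto (fun q : ℝ => c * (1 + q * z) + d * (1 - q * z)) (𝓝[<] 1)
      (𝓝 (c * (1 + z) + d * (1 - z))) := by
    intro c d z
    have : Continuous fun q : ℝ => c * (1 + q * z) + d * (1 - q * z) := by fun_prop
    simpa using (this.tendsto 1).mono_left nhdsWithin_le_nhds
  refine le_of_tendsto_of_tendsto (((hcont _ _ _).const_mul a).add ((hcont _ _ _).const_mul b))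
    (hcont _ _ _) ?_
  filter_upwards [self_mem_nhdsWithin, nhdsWithin_le_nhds (Ioi_mem_nhds zero_lt_one)]
    with q (hq1 : q < 1) (hq0 : 0 < q)
  exact hq q hq0.le hq1

open Set Filter Topology in
lemma Subentropic.differentiableAt_deriv {f : ℝ → ℝ} (hf : Subentropic f) {t : ℝ} (ht : 0 < t) :
    DifferentiableAt ℝ (deriv f) t := by
  have hti : t ∈ interior (Ioi (0 : ℝ)) := by simpa using ht
  have hconv := hf.concaveOn_deriv.neg
  obtain ⟨l, hl⟩ : ∃ l, HasDerivWithinAt (deriv f) l (Iio t) t :=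
    ⟨_, by simpa using (hconv.hasDerivWithinAt_leftDeriv_of_mem_interior hti).neg⟩
  obtain ⟨r, hr⟩ : ∃ r, HasDerivWithinAt (deriv f) r (Ioi t) t :=
    ⟨_, by simpa using (hconv.hasDerivWithinAt_rightDeriv_of_mem_interior hti).neg⟩
  have hrl : r ≤ l := by
    have h := hconv.leftDeriv_le_rightDeriv_of_mem_interior hti
    rw [hl.neg.derivWithin (uniqueDiffWithinAt_Iio t),
      hr.neg.derivWithin (uniqueDiffWithinAt_Ioi t)] at h
    linarith
  have hlr : l ≤ r := by
    have hR : ∀ s : ℝ, 0 < s → Tendsto (fun ε => (deriv f (t + ε * s) - deriv f t) / ε) (𝓝[>] 0)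
        (𝓝 (r * s)) := fun s hs =>
      hr.tendsto_div_add_mul fun ε hε => by
        have := mul_pos hε hs
        simpa using this
    have hL : ∀ s : ℝ, s < 0 → Tendsto (fun ε => (deriv f (t + ε * s) - deriv f t) / ε) (𝓝[>] 0)
        (𝓝 (l * s)) := fun s hs =>
      hl.tendsto_div_add_mul fun ε hε => by
        have := mul_neg_of_pos_of_neg hε hs
        simpa using this
    have key := le_of_tendsto_of_tendsto
      (((((hR 5 (by norm_num)).mul_const (25 / 13)).add
          ((hL (-21) (by norm_num)).mul_const (1 / 13))).const_mul (7 / 11)).add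
        ((((hR 34 (by norm_num)).mul_const (8 / 5)).add
          ((hL (-6) (by norm_num)).mul_const (2 / 5))).const_mul (4 / 11)))
      (((hR 15 (by norm_num)).mul_const (9 / 5)).add ((hL (-15) (by norm_num)).mul_const (1 / 5)))
      (by
        filter_upwards [self_mem_nhdsWithin,
          nhdsWithin_le_nhds (Iio_mem_nhds (show (0 : ℝ) < t / 21 by positivity))]
          with ε (hε : 0 < ε) (hεt : ε < t / 21)
        have h := hf.deriv_two_le (a := 7 / 11) (b := 4 / 11) (by norm_num) (by norm_num)
          (by norm_num) (x := 12 * ε) (m₁ := t - 8 * ε) (y₁ := 5 * ε) (r₁ := 13 * ε)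
          (m₂ := t + 14 * ε) (y₂ := 16 * ε) (r₂ := 20 * ε) (m := t) (y := 9 * ε) (r := 15 * ε)
          (by positivity) (by positivity) (by positivity) (by linarith) (by linarith) (by linarith)
          (by ring) (by ring) (by ring) (by ring) (by ring)
        simp only [mul_div_mul_right _ _ hε.ne'] at h
        rw [show t - 8 * ε + 13 * ε = t + ε * 5 by ring,
          show t - 8 * ε - 13 * ε = t + ε * (-21) by ring,
          show t + 14 * ε + 20 * ε = t + ε * 34 by ring,
          show t + 14 * ε - 20 * ε = t + ε * (-6) by ring,
          show t + 15 * ε = t + ε * 15 by ring,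
          show t - 15 * ε = t + ε * (-15) by ring] at h
        simp only [div_eq_mul_inv _ ε, mul_right_comm _ ε⁻¹, ← mul_assoc, ← add_mul]
        refine mul_le_mul_of_nonneg_right ?_ (by positivity)
        linarith)
    linarith
  rw [le_antisymm hlr hrl] at hl
  exact (hl.hasDerivAt_of_Iio_Ioi hr).differentiableAt

lemma Subentropic.deriv_eq_const_of_three_quarters_le {f : ℝ → ℝ} (hf : Subentropic f) {c s : ℝ}
    (hs : 0 < s) (hc : ∀ t, s ≤ t → deriv f t = c) {t : ℝ} (ht : 3 / 4 * s ≤ t) :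
    deriv f t = c := by
  rcases le_or_gt s t with hst | hst
  · exact hc t hst
  refine le_antisymm ?_ ?_
  · rw [← hc s le_rfl]
    exact hf.monotoneOn_deriv (Set.mem_Ioi.mpr (by linarith)) hs hst.le
  · obtain ⟨l, rfl⟩ : ∃ l, t = s - 10 * l := ⟨(s - t) / 10, by ring⟩
    have hl : 0 < l := by linarith
    have h := hf.deriv_two_le (a := 4 / 9) (b := 5 / 9) (by norm_num) (by norm_num)
      (by norm_num) (x := 12 * l) (m₁ := s - 12 * l) (y₁ := 0) (r₁ := 12 * l)
      (m₂ := s + 15 * l) (y₂ := 9 * l) (r₂ := 15 * l) (m := s + 3 * l) (y := 5 * l) (r := 13 * l)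
      (by positivity) (by positivity) (by positivity) (by linarith) (by linarith) (by linarith)
      (by ring) (by ring) (by ring) (by ring) (by ring)
    simp only [mul_div_mul_right _ _ hl.ne'] at h
    rw [hc (s - 12 * l + 12 * l) (by linarith), hc (s + 15 * l + 15 * l) (by linarith),
      hc (s + 15 * l - 15 * l) (by linarith), hc (s + 3 * l + 13 * l) (by linarith),
      show s + 3 * l - 13 * l = s - 10 * l by ring] at h
    linarith

lemma Subentropic.deriv_eq_of_eventually_const {f : ℝ → ℝ} (hf : Subentropic f) {c s : ℝ}
    (hs : 0 < s) (hc : ∀ t, s ≤ t → deriv f t = c) {t : ℝ} (ht : 0 < t) : deriv f t = c := by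
  have hn : ∀ n : ℕ, ∀ t, (3 / 4) ^ n * s ≤ t → deriv f t = c := by
    intro n
    induction n with
    | zero => simpa using hc
    | succ n ih =>
      intro t ht
      exact hf.deriv_eq_const_of_three_quarters_le (by positivity) ih
        (by rwa [pow_succ', mul_assoc] at ht)
  obtain ⟨n, hn'⟩ := exists_pow_lt_of_lt_one (div_pos ht hs) (show (3 / 4 : ℝ) < 1 by norm_num)
  exact hn n t ((lt_div_iff₀ hs).mp hn').le

open Set in
lemma exists_affine_of_deriv_eq_const {f : ℝ → ℝ} {c : ℝ}
    (hd : ∀ t > (0 : ℝ), DifferentiableAt ℝ f t) (hc : ∀ t > (0 : ℝ), deriv f t = c) :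
    ∃ a b : ℝ, ∀ t > (0 : ℝ), f t = a * t + b := by
  have hder : ∀ t > (0 : ℝ), HasDerivAt (fun t => f t - c * t) 0 t := by
    intro t ht
    have h : HasDerivAt (fun t => f t - c * t) (deriv f t - c * 1) t :=
      (hd t ht).hasDerivAt.sub ((hasDerivAt_id t).const_mul c)
    rwa [hc t ht, mul_one, sub_self] at h
  refine ⟨c, f 1 - c * 1, fun t ht => ?_⟩
  have h := isOpen_Ioi.is_const_of_deriv_eq_zero (convex_Ioi (0 : ℝ)).isPreconnected
    (fun t ht => (hder t ht).differentiableAt.differentiableWithinAt)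
    (fun t ht => (hder t ht).deriv) (mem_Ioi.mpr ht) (mem_Ioi.mpr zero_lt_one)
  linarith

open Set in
lemma MonotoneOn.deriv_nonneg_of_isOpen {h : ℝ → ℝ} {S : Set ℝ} (hh : MonotoneOn h S)
    (hS : IsOpen S) {t : ℝ} (ht : t ∈ S) : 0 ≤ deriv h t := by
  rw [← derivWithin_of_isOpen hS ht]
  exact hh.derivWithin_nonneg

open Set in
lemma Subentropic.antitoneOn_deriv_deriv {f : ℝ → ℝ} (hf : Subentropic f) :
    AntitoneOn (deriv (deriv f)) (Ioi 0) :=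
  hf.concaveOn_deriv.antitoneOn_deriv fun _ ht => hf.differentiableAt_deriv ht

open Set in
lemma Subentropic.deriv_deriv_pos {f : ℝ → ℝ} (hf : Subentropic f)
    (hna : ¬ ∃ a b : ℝ, ∀ t > (0 : ℝ), f t = a * t + b) {s : ℝ} (hs : 0 < s) :
    0 < deriv (deriv f) s := by
  refine (hf.monotoneOn_deriv.deriv_nonneg_of_isOpen isOpen_Ioi hs).lt_of_ne' fun h0 => hna ?_
  refine exists_affine_of_deriv_eq_const (fun t ht => hf.differentiableAt ht)
    fun t ht => hf.deriv_eq_of_eventually_const (c := deriv f s) hs (fun t hst => ?_) ht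
  rcases hst.eq_or_lt with rfl | hst
  · rfl
  have ht : 0 < t := hs.trans hst
  refine le_antisymm ?_ (hf.monotoneOn_deriv hs ht hst.le)
  have h := hf.concaveOn_deriv.slope_le_deriv hs ht hst (hf.differentiableAt_deriv hs)
  rw [h0, slope_def_field, div_le_iff₀ (sub_pos.mpr hst), zero_mul] at h
  linarith

open Set in
lemma Subentropic.two_mul_deriv_deriv_le {f : ℝ → ℝ} (hf : Subentropic f) {t : ℝ} (ht : 0 < t) :
    2 * deriv (deriv f) (2 * t) ≤ deriv (deriv f) t := by
  have hconv : ConvexOn ℝ (Ioi 0) (fun t => -f (2 * t) + 2 * f t) := by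
    refine ⟨convex_Ioi 0, fun x hx y hy a b ha hb hab => ?_⟩
    have key := hf.scalar_le ha hb hab hx hy hx hy
    simp only [smul_eq_mul, two_mul]
    exact key
  have hmul : ∀ t : ℝ, HasDerivAt (fun t : ℝ => 2 * t) 2 t := fun t => by
    simpa using (hasDerivAt_id t).const_mul (2 : ℝ)
  have h1 : ∀ t > 0, HasDerivAt (fun t => -f (2 * t) + 2 * f t)
      (-(deriv f (2 * t) * 2) + 2 * deriv f t) t := fun t ht =>
    ((hf.differentiableAt (t := 2 * t) (by positivity)).hasDerivAt.comp t (hmul t)).neg.add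
      ((hf.differentiableAt ht).hasDerivAt.const_mul 2)
  have hmono : MonotoneOn (fun t => -(deriv f (2 * t) * 2) + 2 * deriv f t) (Ioi 0) :=
    (hconv.monotoneOn_deriv fun t ht => (h1 t ht).differentiableAt).congr
      fun t ht => (h1 t ht).deriv
  have h2 : HasDerivAt (fun t => -(deriv f (2 * t) * 2) + 2 * deriv f t)
      (-(deriv (deriv f) (2 * t) * 2 * 2) + 2 * deriv (deriv f) t) t :=
    (((hf.differentiableAt_deriv (t := 2 * t) (by positivity)).hasDerivAt.comp t
      (hmul t)).mul_const 2).neg.add ((hf.differentiableAt_deriv ht).hasDerivAt.const_mul 2)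
  have h := hmono.deriv_nonneg_of_isOpen isOpen_Ioi (mem_Ioi.mpr ht)
  rw [h2.deriv] at h
  linarith

open Set Filter Topology in
lemma Subentropic.tendsto_deriv_deriv_atTop {f : ℝ → ℝ} (hf : Subentropic f)
    (hna : ¬ ∃ a b : ℝ, ∀ t > (0 : ℝ), f t = a * t + b) :
    Tendsto (deriv (deriv f)) (𝓝[>] 0) atTop := by
  have hpow : ∀ n : ℕ, 2 ^ n * deriv (deriv f) 1 ≤ deriv (deriv f) ((1 / 2) ^ n) := by
    intro n
    induction n with
    | zero => simp
    | succ n ih =>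
      have h := hf.two_mul_deriv_deriv_le (t := (1 / 2) ^ (n + 1)) (by positivity)
      rw [show (2 : ℝ) * (1 / 2) ^ (n + 1) = (1 / 2) ^ n by ring] at h
      rw [pow_succ]
      linarith
  refine tendsto_atTop.mpr fun M => ?_
  obtain ⟨n, hn⟩ := pow_unbounded_of_one_lt (M / deriv (deriv f) 1) (one_lt_two (α := ℝ))
  have hM := (div_lt_iff₀ (hf.deriv_deriv_pos hna one_pos)).mp hn
  filter_upwards [self_mem_nhdsWithin,
    nhdsWithin_le_nhds (Iio_mem_nhds (show (0 : ℝ) < (1 / 2) ^ n by positivity))]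
    with t (ht : 0 < t) (htn : t < (1 / 2) ^ n)
  exact hM.le.trans ((hpow n).trans
    (hf.antitoneOn_deriv_deriv ht (mem_Ioi.mpr (by positivity)) htn.le))

/-- For a non-affine subentropic function `f`, the function
`g(t) = 1/f''(t)` is increasing on `(0,∞)` and `g(t) → 0` as `t → 0⁺`; equivalently
`f''(t) → ∞` as `t → 0⁺`. -/
theorem subentropic_reciprocal_second_deriv_increasing (f : ℝ → ℝ)
    (hf : Subentropic f) (hna : ¬ ∃ a b : ℝ, ∀ t > (0 : ℝ), f t = a * t + b) :
    MonotoneOn (fun t => 1 / deriv (deriv f) t) (Set.Ioi 0) ∧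
    Filter.Tendsto (fun t => 1 / deriv (deriv f) t)
      (nhdsWithin 0 (Set.Ioi 0)) (nhds 0) ∧
    Filter.Tendsto (deriv (deriv f)) (nhdsWithin 0 (Set.Ioi 0)) Filter.atTop := by
  have htop := hf.tendsto_deriv_deriv_atTop hna
  refine ⟨fun s hs t ht hst => ?_, ?_, htop⟩
  · exact one_div_le_one_div_of_le (hf.deriv_deriv_pos hna ht)
      (hf.antitoneOn_deriv_deriv hs ht hst)
  · simpa only [one_div, Function.comp_def] using tendsto_inv_atTop_zero.comp htop

end
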